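/- Let (X,w) be a Euclidean 6-design in ℝ^22 supported by exactly two concentric spheres of positive radii r1, r2 centered at the origin, with fibers X1 and X2, |X| = 2300 and |X1| = 275. Then the weight function w is constant on each fiber, say w ≡ w1 on X1 and w ≡ w2 on X2, and moreover r2/r1 = √11 and w2/w1 = 1/729 (where the fiber of 275 points is labeled X1). -/

import Mathlib

open MeasureTheory Metric MvPolynomial
open scoped RealInnerProductSpace Classical

/-- Average of a polynomial over the sphere of radius `r` centered at the origin in `ℝⁿ`,
with respect to the (rotation-invariant, normalized) surface measure. -/
noncomputable def sphereAvg (n : ℕ) (r : ℝ) (f : MvPolynomial (Fin n) ℝ) : ℝ :=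
  ⨍ u : sphere (0 : EuclideanSpace ℝ (Fin n)) 1,
    eval (fun i => r * (u : EuclideanSpace ℝ (Fin n)) i) f
    ∂((volume : Measure (EuclideanSpace ℝ (Fin n))).toSphere)

/-- `(X₁ ∪ X₂, w)` is a Euclidean `t`-design of `ℝ²²` supported by the two concentric spheres
of radii `r₁` and `r₂` centered at the origin, with fibers `X₁ ⊆ S(0,r₁)` and `X₂ ⊆ S(0,r₂)`. -/
def IsEuclideanDesignTwoSpheres (t : ℕ) (X₁ X₂ : Finset (EuclideanSpace ℝ (Fin 22)))
    (w : EuclideanSpace ℝ (Fin 22) → ℝ) (r₁ r₂ : ℝ) : Prop :=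
  ∀ f : MvPolynomial (Fin 22) ℝ, f.totalDegree ≤ t →
    (∑ x ∈ X₁, w x) * sphereAvg 22 r₁ f + (∑ x ∈ X₂, w x) * sphereAvg 22 r₂ f
      = ∑ x ∈ X₁ ∪ X₂, w x * eval (x : Fin 22 → ℝ) f

open scoped Pointwise in
/-- A linear isometry preserves averages over the unit sphere. -/
lemma average_sphere_comp_linearIsometryEquiv {E : Type*} [NormedAddCommGroup E]
    [InnerProductSpace ℝ E] [FiniteDimensional ℝ E] [MeasurableSpace E] [BorelSpace E]
    (L : E ≃ₗᵢ[ℝ] E) {f : E → ℝ} (hf : Continuous f) :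
    ⨍ u : sphere (0 : E) 1, f (L u) ∂(volume : Measure E).toSphere
      = ⨍ u : sphere (0 : E) 1, f u ∂(volume : Measure E).toSphere := by
  have hmem : ∀ u : sphere (0 : E) 1, L u ∈ sphere (0 : E) 1 := fun u => by simp
  let g : sphere (0 : E) 1 → sphere (0 : E) 1 := fun u => ⟨L u, hmem u⟩
  have hg : Continuous g := (L.continuous.comp continuous_subtype_val).subtype_mk _
  have hmap : (volume : Measure E).toSphere.map g = (volume : Measure E).toSphere := by
    ext s hs
    rw [Measure.map_apply hg.measurable hs, Measure.toSphere_apply' _ (hg.measurable hs),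
      Measure.toSphere_apply' _ hs, ← L.measurePreserving.measure_preimage_emb
        L.toHomeomorph.measurableEmbedding (Set.Ioo (0 : ℝ) 1 • (Subtype.val '' s))]
    congr 2
    ext x
    simp only [Set.mem_smul, Set.mem_image, Set.mem_preimage]
    constructor
    · rintro ⟨r, hr, _, ⟨u, hu, rfl⟩, rfl⟩
      exact ⟨r, hr, _, ⟨g u, hu, rfl⟩, by simp [g]⟩
    · rintro ⟨r, hr, _, ⟨u, hu, rfl⟩, hx⟩
      refine ⟨r, hr, L.symm u, ⟨⟨L.symm u, by simp⟩, by simpa [g] using hu, rfl⟩, ?_⟩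
      apply L.injective
      simpa using hx
  rw [average_eq, average_eq]
  congr 1
  have h := integral_map (μ := (volume : Measure E).toSphere) (φ := g) (f := fun u => f u)
    hg.measurable.aemeasurable
    (hf.comp continuous_subtype_val).aestronglyMeasurable
  rw [hmap] at h
  exact h.symm

lemma integrable_sphere {E : Type*} [NormedAddCommGroup E]
    [InnerProductSpace ℝ E] [FiniteDimensional ℝ E] [MeasurableSpace E] [BorelSpace E]
    {f : E → ℝ} (hf : Continuous f) :
    Integrable (fun u : sphere (0 : E) 1 => f u) ((volume : Measure E).toSphere) := by
  have : CompactSpace (sphere (0 : E) 1) := isCompact_iff_compactSpace.1 (isCompact_sphere _ _)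
  exact (hf.comp continuous_subtype_val).integrable_of_hasCompactSupport
    (HasCompactSupport.of_compactSpace _)

/-- Moments of `⟪v, ·⟫` on the unit sphere do not depend on the unit vector `v`. -/
lemma average_inner_pow_eq {E : Type*} [NormedAddCommGroup E]
    [InnerProductSpace ℝ E] [FiniteDimensional ℝ E] [MeasurableSpace E] [BorelSpace E]
    {v v' : E} (h : ‖v‖ = ‖v'‖) (k : ℕ) :
    ⨍ u : sphere (0 : E) 1, inner ℝ v u ^ k ∂(volume : Measure E).toSphere
      = ⨍ u : sphere (0 : E) 1, inner ℝ v' u ^ k ∂(volume : Measure E).toSphere := by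
  let L := (ℝ ∙ (v - v'))ᗮ.reflection
  have hL : L v = v' := Submodule.reflection_sub h
  rw [← average_sphere_comp_linearIsometryEquiv L (f := fun u => inner ℝ v' u ^ k)
    (by fun_prop)]
  simp only [← hL, LinearIsometryEquiv.inner_map_map]

lemma average_inner_pow_odd {E : Type*} [NormedAddCommGroup E]
    [InnerProductSpace ℝ E] [FiniteDimensional ℝ E] [MeasurableSpace E] [BorelSpace E]
    (v : E) {k : ℕ} (hk : Odd k) :
    ⨍ u : sphere (0 : E) 1, inner ℝ v u ^ k ∂(volume : Measure E).toSphere = 0 := by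
  have h := average_inner_pow_eq (norm_neg v) k
  simp only [inner_neg_left, hk.neg_pow] at h
  rw [average_eq, average_eq, integral_neg, smul_neg] at h
  rw [average_eq]
  linarith

/-- The average over the unit sphere, as a linear functional on continuous functions. -/
noncomputable def sphereMean (n : ℕ) : C(EuclideanSpace ℝ (Fin n), ℝ) →ₗ[ℝ] ℝ where
  toFun f := ⨍ u : sphere (0 : EuclideanSpace ℝ (Fin n)) 1, f u
    ∂((volume : Measure (EuclideanSpace ℝ (Fin n))).toSphere)
  map_add' f g := by
    simp only [average_eq, ContinuousMap.add_apply]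
    rw [integral_add (integrable_sphere f.continuous) (integrable_sphere g.continuous), smul_add]
  map_smul' c f := by
    simp only [average_eq, ContinuousMap.smul_apply, integral_smul, RingHom.id_apply]
    rw [smul_comm]

/-- The continuous linear functional `⟪v, ·⟫`. -/
noncomputable def innerMap {n : ℕ} (v : EuclideanSpace ℝ (Fin n)) :
    C(EuclideanSpace ℝ (Fin n), ℝ) := ⟨fun u => inner ℝ v u, by fun_prop⟩

lemma sphereMean_one {n : ℕ} (hn : 0 < n) : sphereMean n 1 = 1 := by
  have : NeZero n := ⟨hn.ne'⟩
  have : Nontrivial (EuclideanSpace ℝ (Fin n)) := by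
    have := Fin.pos_iff_nonempty.1 hn
    infer_instance
  have : NeZero ((volume : Measure (EuclideanSpace ℝ (Fin n))).toSphere) :=
    ⟨Measure.toSphere_ne_zero _⟩
  exact average_const _ _

lemma sphereMean_pow_eq {n : ℕ} {v v' : EuclideanSpace ℝ (Fin n)} (h : ‖v‖ = ‖v'‖) (k : ℕ) :
    sphereMean n (innerMap v ^ k) = sphereMean n (innerMap v' ^ k) :=
  average_inner_pow_eq h k

lemma sphereMean_pow_odd {n : ℕ} (v : EuclideanSpace ℝ (Fin n)) {k : ℕ} (hk : Odd k) :
    sphereMean n (innerMap v ^ k) = 0 :=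
  average_inner_pow_odd v hk

lemma sphereMean_congr {n : ℕ} {f g : C(EuclideanSpace ℝ (Fin n), ℝ)}
    (h : ∀ u, ‖u‖ = 1 → f u = g u) : sphereMean n f = sphereMean n g := by
  change average _ _ = average _ _
  congr 1
  ext u
  exact h u (by simp)

lemma innerMap_add {n : ℕ} (v v' : EuclideanSpace ℝ (Fin n)) :
    innerMap (v + v') = innerMap v + innerMap v' := by
  ext u; simp [innerMap, inner_add_left]

lemma innerMap_smul {n : ℕ} (c : ℝ) (v : EuclideanSpace ℝ (Fin n)) :
    innerMap (c • v) = c • innerMap v := by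
  ext u; simp [innerMap, inner_smul_left]

lemma sum_sphereMean_mul_sq {n : ℕ} (f : C(EuclideanSpace ℝ (Fin n), ℝ)) :
    ∑ i, sphereMean n (f * innerMap (EuclideanSpace.single i 1) ^ 2) = sphereMean n f := by
  rw [← map_sum]
  apply sphereMean_congr
  intro u hu
  have h1 : ∑ i, u i ^ 2 = 1 := by
    rw [← EuclideanSpace.real_norm_sq_eq, hu, one_pow]
  simp [innerMap, ← Finset.mul_sum, h1, EuclideanSpace.inner_single_left]

section Orthonormal

variable {n : ℕ} {v v' : EuclideanSpace ℝ (Fin n)}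

lemma norm_add_eq_norm_sqrt_two_smul (hv : ‖v‖ = 1) (hv' : ‖v'‖ = 1) (h : inner ℝ v v' = 0) :
    ‖v + v'‖ = ‖√2 • v‖ := by
  rw [norm_smul, hv, mul_one, Real.norm_of_nonneg (by positivity)]
  rw [← sq_eq_sq₀ (by positivity) (by positivity), Real.sq_sqrt (by norm_num), norm_add_sq_real,
    hv, hv', h]
  norm_num

lemma norm_sub_eq_norm_sqrt_two_smul (hv : ‖v‖ = 1) (hv' : ‖v'‖ = 1) (h : inner ℝ v v' = 0) :
    ‖v + (-1 : ℝ) • v'‖ = ‖√2 • v‖ := by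
  apply norm_add_eq_norm_sqrt_two_smul hv <;> simp [hv', h]

lemma sphereMean_sq_mul_sq (hv : ‖v‖ = 1) (hv' : ‖v'‖ = 1) (h : inner ℝ v v' = 0) :
    sphereMean n (innerMap v ^ 2 * innerMap v' ^ 2) = sphereMean n (innerMap v ^ 4) / 3 := by
  have h1 := sphereMean_pow_eq (norm_add_eq_norm_sqrt_two_smul hv hv' h) 4
  have h2 := sphereMean_pow_eq (norm_sub_eq_norm_sqrt_two_smul hv hv' h) 4
  have h3 := sphereMean_pow_eq (hv'.trans hv.symm) 4
  have h4 : (√2) ^ 4 = 4 := by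
    rw [show (√2) ^ 4 = ((√2) ^ 2) ^ 2 by ring, Real.sq_sqrt (by norm_num)]; norm_num
  rw [innerMap_smul _ v, smul_pow, map_smul, h4, smul_eq_mul] at h1 h2
  rw [innerMap_add] at h1 h2
  rw [innerMap_smul] at h2
  have h5 : (innerMap v + innerMap v') ^ 4 + (innerMap v + (-1 : ℝ) • innerMap v') ^ 4
      = (2 : ℝ) • innerMap v ^ 4 + (2 : ℝ) • innerMap v' ^ 4
        + (12 : ℝ) • (innerMap v ^ 2 * innerMap v' ^ 2) := by
    ext u; simp; ring
  have h6 := congrArg (sphereMean n) h5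
  simp only [map_add, map_smul, smul_eq_mul] at h6
  linarith

lemma sphereMean_pow_four_mul_sq (hv : ‖v‖ = 1) (hv' : ‖v'‖ = 1) (h : inner ℝ v v' = 0) :
    sphereMean n (innerMap v ^ 4 * innerMap v' ^ 2) = sphereMean n (innerMap v ^ 6) / 5 := by
  have hvv : sphereMean n (innerMap v ^ 4 * innerMap v' ^ 2)
      = sphereMean n (innerMap v' ^ 4 * innerMap v ^ 2) := by
    let L := (ℝ ∙ (v - v'))ᗮ.reflection
    have hL : L v = v' := Submodule.reflection_sub (hv.trans hv'.symm)
    have hL' : L v' = v := by rw [← hL]; exact Submodule.reflection_reflection _ _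
    have := average_sphere_comp_linearIsometryEquiv L
      (f := fun u => inner ℝ v' u ^ 4 * inner ℝ v u ^ 2) (by fun_prop)
    refine Eq.trans ?_ this
    change average _ _ = average _ _
    congr 1
    ext u
    have e1 : inner ℝ v' (L u) = inner ℝ v (u : EuclideanSpace ℝ (Fin n)) :=
      hL ▸ L.inner_map_map v u
    have e2 : inner ℝ v (L u) = inner ℝ v' (u : EuclideanSpace ℝ (Fin n)) := by
      rw [← L.inner_map_map v' u, hL']
    simp [innerMap, e1, e2]
  have h1 := sphereMean_pow_eq (norm_add_eq_norm_sqrt_two_smul hv hv' h) 6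
  have h2 := sphereMean_pow_eq (norm_sub_eq_norm_sqrt_two_smul hv hv' h) 6
  have h3 := sphereMean_pow_eq (hv'.trans hv.symm) 6
  have h4 : (√2) ^ 6 = 8 := by
    rw [show (√2) ^ 6 = ((√2) ^ 2) ^ 3 by ring, Real.sq_sqrt (by norm_num)]; norm_num
  rw [innerMap_smul _ v, smul_pow, map_smul, h4, smul_eq_mul] at h1 h2
  rw [innerMap_add] at h1 h2
  rw [innerMap_smul] at h2
  have h5 : (innerMap v + innerMap v') ^ 6 + (innerMap v + (-1 : ℝ) • innerMap v') ^ 6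
      = (2 : ℝ) • innerMap v ^ 6 + (2 : ℝ) • innerMap v' ^ 6
        + (30 : ℝ) • (innerMap v ^ 4 * innerMap v' ^ 2)
        + (30 : ℝ) • (innerMap v' ^ 4 * innerMap v ^ 2) := by
    ext u; simp; ring
  have h6 := congrArg (sphereMean n) h5
  simp only [map_add, map_smul, smul_eq_mul] at h6
  linarith

end Orthonormal

lemma sphereMean_sq {n : ℕ} {v : EuclideanSpace ℝ (Fin n)} (hv : ‖v‖ = 1) (hn : 0 < n) :
    n * sphereMean n (innerMap v ^ 2) = 1 := by
  have h := sum_sphereMean_mul_sq (n := n) 1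
  rw [sphereMean_one hn] at h
  rw [← h]
  have : ∀ i : Fin n, sphereMean n (1 * innerMap (EuclideanSpace.single i 1) ^ 2)
      = sphereMean n (innerMap v ^ 2) := fun i => by
    rw [one_mul]; exact sphereMean_pow_eq (by simp [hv]) 2
  rw [Finset.sum_congr rfl fun i _ => this i]
  simp

lemma sphereMean_pow_four {n : ℕ} {v : EuclideanSpace ℝ (Fin n)} (hv : ‖v‖ = 1) (hn : 0 < n) :
    n * (n + 2) * sphereMean n (innerMap v ^ 4) = 3 := by
  let e : Fin n → EuclideanSpace ℝ (Fin n) := fun i => EuclideanSpace.single i 1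
  let j : Fin n := ⟨0, hn⟩
  have h := sum_sphereMean_mul_sq (n := n) (innerMap (e j) ^ 2)
  have h2 : ∀ i, sphereMean n (innerMap (e j) ^ 2 * innerMap (EuclideanSpace.single i 1) ^ 2)
      = sphereMean n (innerMap v ^ 4) / 3
        + if i = j then 2 * sphereMean n (innerMap v ^ 4) / 3 else 0 := fun i => by
    have hj := sphereMean_pow_eq (v := e j) (v' := v) (by simp [e, hv]) 4
    split_ifs with hij
    · subst hij
      rw [← pow_add, hj]; ring
    · rw [sphereMean_sq_mul_sq (by simp [e]) (by simp), hj, add_zero]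
      simp [e, EuclideanSpace.inner_single_left, Ne.symm hij]
  rw [Finset.sum_congr rfl fun i _ => h2 i, Finset.sum_add_distrib] at h
  simp only [Finset.sum_const, Finset.card_univ, Fintype.card_fin, nsmul_eq_mul,
    Finset.sum_ite_eq', Finset.mem_univ, if_true] at h
  have h3 := sphereMean_sq (v := e j) (by simp [e]) hn
  rw [← h] at h3
  linarith

lemma sphereMean_pow_six {n : ℕ} {v : EuclideanSpace ℝ (Fin n)} (hv : ‖v‖ = 1) (hn : 0 < n) :
    n * (n + 2) * (n + 4) * sphereMean n (innerMap v ^ 6) = 15 := by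
  let e : Fin n → EuclideanSpace ℝ (Fin n) := fun i => EuclideanSpace.single i 1
  let j : Fin n := ⟨0, hn⟩
  have h := sum_sphereMean_mul_sq (n := n) (innerMap (e j) ^ 4)
  have h2 : ∀ i, sphereMean n (innerMap (e j) ^ 4 * innerMap (EuclideanSpace.single i 1) ^ 2)
      = sphereMean n (innerMap v ^ 6) / 5
        + if i = j then 4 * sphereMean n (innerMap v ^ 6) / 5 else 0 := fun i => by
    have hj := sphereMean_pow_eq (v := e j) (v' := v) (by simp [e, hv]) 6
    split_ifs with hij
    · subst hij
      rw [← pow_add, hj]; ring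
    · rw [sphereMean_pow_four_mul_sq (by simp [e]) (by simp), hj, add_zero]
      simp [e, EuclideanSpace.inner_single_left, Ne.symm hij]
  rw [Finset.sum_congr rfl fun i _ => h2 i, Finset.sum_add_distrib] at h
  simp only [Finset.sum_const, Finset.card_univ, Fintype.card_fin, nsmul_eq_mul,
    Finset.sum_ite_eq', Finset.mem_univ, if_true] at h
  have h3 := sphereMean_pow_four (v := e j) (by simp [e]) hn
  rw [← h] at h3
  linarith

/-- The linear form `⟪x, ·⟫` as a polynomial. -/
noncomputable def linForm {n : ℕ} (x : EuclideanSpace ℝ (Fin n)) : MvPolynomial (Fin n) ℝ :=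
  ∑ i, C (x i) * X i

/-- The squared Euclidean norm as a polynomial. -/
noncomputable def normSqPoly (n : ℕ) : MvPolynomial (Fin n) ℝ := ∑ i, X i ^ 2

lemma eval_linForm {n : ℕ} (x y : EuclideanSpace ℝ (Fin n)) :
    eval (y : Fin n → ℝ) (linForm x) = inner ℝ x y := by
  simp [linForm, PiLp.inner_apply, mul_comm]

lemma eval_normSqPoly {n : ℕ} (y : EuclideanSpace ℝ (Fin n)) :
    eval (y : Fin n → ℝ) (normSqPoly n) = ‖y‖ ^ 2 := by
  simp [normSqPoly, EuclideanSpace.real_norm_sq_eq]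

lemma totalDegree_linForm_le {n : ℕ} (x : EuclideanSpace ℝ (Fin n)) :
    (linForm x).totalDegree ≤ 1 := by
  refine totalDegree_finsetSum_le fun i _ => (totalDegree_mul _ _).trans ?_
  simp

lemma totalDegree_normSqPoly_le (n : ℕ) : (normSqPoly n).totalDegree ≤ 2 := by
  refine totalDegree_finsetSum_le fun i _ => ?_
  simp

/-- The average over a sphere in `ℝ²²` of a polynomial which agrees on it with a univariate
polynomial of degree at most `6` in `⟪v, ·⟫`. -/
lemma sphereAvg_eq {r s : ℝ} (hr : 0 ≤ r) (hs : 0 < s) {v : EuclideanSpace ℝ (Fin 22)}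
    (hv : ‖v‖ = s) (f : MvPolynomial (Fin 22) ℝ) (a₀ a₁ a₂ a₃ a₄ a₅ a₆ : ℝ)
    (h : ∀ z : EuclideanSpace ℝ (Fin 22), ‖z‖ = r → eval (z : Fin 22 → ℝ) f
      = a₀ + a₁ * inner ℝ v z + a₂ * inner ℝ v z ^ 2 + a₃ * inner ℝ v z ^ 3
        + a₄ * inner ℝ v z ^ 4 + a₅ * inner ℝ v z ^ 5 + a₆ * inner ℝ v z ^ 6) :
    sphereAvg 22 r f = a₀ + a₂ * ((r * s) ^ 2 / 22) + a₄ * ((r * s) ^ 4 / 176)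
      + a₆ * ((r * s) ^ 6 * 5 / 4576) := by
  have hv' : ‖s⁻¹ • v‖ = 1 := by
    rw [norm_smul, hv, Real.norm_of_nonneg (by positivity), inv_mul_cancel₀ hs.ne']
  set v' := s⁻¹ • v with hv'_def
  have hvv : v = s • v' := by rw [hv'_def, smul_inv_smul₀ hs.ne']
  have h2 := sphereMean_sq hv' (by norm_num)
  have h4 := sphereMean_pow_four hv' (by norm_num)
  have h6 := sphereMean_pow_six hv' (by norm_num)
  have h0 := sphereMean_one (n := 22) (by norm_num)
  have h1 := sphereMean_pow_odd v' (k := 1) (by decide)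
  have h3 := sphereMean_pow_odd v' (k := 3) (by decide)
  have h5 := sphereMean_pow_odd v' (k := 5) (by decide)
  push_cast at h2 h4 h6
  have key : sphereAvg 22 r f = sphereMean 22 (a₀ • 1 + (a₁ * (r * s)) • innerMap v' ^ 1
      + (a₂ * (r * s) ^ 2) • innerMap v' ^ 2
      + (a₃ * (r * s) ^ 3) • innerMap v' ^ 3 + (a₄ * (r * s) ^ 4) • innerMap v' ^ 4
      + (a₅ * (r * s) ^ 5) • innerMap v' ^ 5 + (a₆ * (r * s) ^ 6) • innerMap v' ^ 6) := by
    change average _ _ = average _ _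
    congr 1
    ext u
    have hu : ‖r • (u : EuclideanSpace ℝ (Fin 22))‖ = r := by
      rw [norm_smul, norm_eq_of_mem_sphere, mul_one, Real.norm_of_nonneg hr]
    have := h _ hu
    rw [hvv] at this
    simp only [inner_smul_left, inner_smul_right] at this
    refine Eq.trans this ?_
    simp [innerMap]
    ring
  rw [key]
  simp only [map_add, map_smul, h0, h1, h3, h5, smul_eq_mul]
  rw [show sphereMean 22 (innerMap v' ^ 2) = 1 / 22 by linarith,
    show sphereMean 22 (innerMap v' ^ 4) = 1 / 176 by linarith,
    show sphereMean 22 (innerMap v' ^ 6) = 5 / 4576 by linarith]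
  ring

lemma IsEuclideanDesignTwoSpheres.symm {t : ℕ} {X₁ X₂ : Finset (EuclideanSpace ℝ (Fin 22))}
    {w : EuclideanSpace ℝ (Fin 22) → ℝ} {r₁ r₂ : ℝ}
    (h : IsEuclideanDesignTwoSpheres t X₁ X₂ w r₁ r₂) :
    IsEuclideanDesignTwoSpheres t X₂ X₁ w r₂ r₁ := fun f hf => by
  rw [Finset.union_comm, ← h f hf, add_comm]

/-- The reproducing kernel of the space of polynomials of degree at most `3` on two concentric
spheres in `ℝ²²` at a point `x` of the sphere of squared radius `ρ`; here `ρ'` is the other squared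
radius, `W` the total weight of the sphere of `x`, and `A₂`, `A₃` are the weighted sums of the
fourth and sixth powers of the radii. -/
noncomputable def kernelPoly (ρ ρ' W A₂ A₃ : ℝ) (x : EuclideanSpace ℝ (Fin 22)) :
    MvPolynomial (Fin 22) ℝ :=
  (normSqPoly 22 - C ρ') * (C (1 / (W * (ρ - ρ'))) + C (22 / (W * ρ * (ρ - ρ'))) * linForm x)
    + C (12 / A₂) * (C 22 * linForm x ^ 2 - C ρ * normSqPoly 22)
    + C (286 / A₃) * (linForm x * (C 8 * linForm x ^ 2 - C ρ * normSqPoly 22))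

lemma eval_kernelPoly (ρ ρ' W A₂ A₃ : ℝ) (x z : EuclideanSpace ℝ (Fin 22)) :
    eval (z : Fin 22 → ℝ) (kernelPoly ρ ρ' W A₂ A₃ x)
      = (‖z‖ ^ 2 - ρ') * (1 / (W * (ρ - ρ')) + 22 / (W * ρ * (ρ - ρ')) * inner ℝ x z)
        + 12 / A₂ * (22 * inner ℝ x z ^ 2 - ρ * ‖z‖ ^ 2)
        + 286 / A₃ * (inner ℝ x z * (8 * inner ℝ x z ^ 2 - ρ * ‖z‖ ^ 2)) := by
  simp only [kernelPoly, map_add, map_mul, map_sub, map_pow, eval_C, eval_linForm,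
    eval_normSqPoly]

lemma totalDegree_normSqPoly_sub_C_le (n : ℕ) (c : ℝ) :
    (normSqPoly n - C c).totalDegree ≤ 2 :=
  (totalDegree_sub_C_le _ _).trans (totalDegree_normSqPoly_le n)

lemma totalDegree_C_mul_le' {n : ℕ} (c : ℝ) (f : MvPolynomial (Fin n) ℝ) :
    (C c * f).totalDegree ≤ f.totalDegree := by
  simpa using totalDegree_mul (C c) f

lemma totalDegree_kernelPoly_le (ρ ρ' W A₂ A₃ : ℝ) (x : EuclideanSpace ℝ (Fin 22)) :
    (kernelPoly ρ ρ' W A₂ A₃ x).totalDegree ≤ 3 := by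
  have hl := totalDegree_linForm_le x
  have hN := totalDegree_normSqPoly_le 22
  have hl2 : (linForm x ^ 2).totalDegree ≤ 2 := (totalDegree_pow _ _).trans (by omega)
  have hq : ∀ c : ℝ, (C c * linForm x ^ 2 - C ρ * normSqPoly 22).totalDegree ≤ 2 := fun c =>
    (totalDegree_sub _ _).trans (max_le ((totalDegree_C_mul_le' _ _).trans hl2)
      ((totalDegree_C_mul_le' _ _).trans hN))
  have hlin : ∀ a b : ℝ, (C a + C b * linForm x).totalDegree ≤ 1 := fun a b =>
    (totalDegree_add _ _).trans (max_le (by simp) ((totalDegree_C_mul_le' _ _).trans hl))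
  refine (totalDegree_add _ _).trans (max_le ((totalDegree_add _ _).trans (max_le ?_ ?_)) ?_)
  · exact (totalDegree_mul _ _).trans
      (Nat.add_le_add (totalDegree_normSqPoly_sub_C_le _ _) (hlin _ _))
  · exact ((totalDegree_C_mul_le' _ _).trans (hq _)).trans (by norm_num)
  · exact (totalDegree_C_mul_le' _ _).trans ((totalDegree_mul _ _).trans
      (Nat.add_le_add hl (hq _)))

/-- The square norm of the reproducing kernel at `x` is its value at `x`. -/
lemma sphereAvg_kernelPoly_sq {r r' W W' : ℝ} (hr : 0 < r) (hr' : 0 < r') (hne : r ≠ r')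
    (hW : 0 < W) (hW' : 0 < W') {x : EuclideanSpace ℝ (Fin 22)} (hx : ‖x‖ = r) {A₂ A₃ : ℝ}
    (hA₂ : A₂ = W * r ^ 4 + W' * r' ^ 4) (hA₃ : A₃ = W * r ^ 6 + W' * r' ^ 6) :
    W * sphereAvg 22 r (kernelPoly (r ^ 2) (r' ^ 2) W A₂ A₃ x ^ 2)
      + W' * sphereAvg 22 r' (kernelPoly (r ^ 2) (r' ^ 2) W A₂ A₃ x ^ 2)
      = 23 / W + 252 * r ^ 4 / A₂ + 2002 * r ^ 6 / A₃ := by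
  have hA₂0 : A₂ ≠ 0 := by rw [hA₂]; positivity
  have hA₃0 : A₃ ≠ 0 := by rw [hA₃]; positivity
  have hd : r ^ 2 - r' ^ 2 ≠ 0 := by
    rw [sq_sub_sq]
    exact mul_ne_zero (by positivity) (sub_ne_zero.2 hne)
  have key : ∀ (R k₀ k₁ k₂ k₃ : ℝ), 0 < R → (∀ z : EuclideanSpace ℝ (Fin 22), ‖z‖ = R →
      eval (z : Fin 22 → ℝ) (kernelPoly (r ^ 2) (r' ^ 2) W A₂ A₃ x)
        = k₀ + k₁ * inner ℝ x z + k₂ * inner ℝ x z ^ 2 + k₃ * inner ℝ x z ^ 3) →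
      sphereAvg 22 R (kernelPoly (r ^ 2) (r' ^ 2) W A₂ A₃ x ^ 2)
        = k₀ ^ 2 + (k₁ ^ 2 + 2 * k₀ * k₂) * ((R * r) ^ 2 / 22)
          + (k₂ ^ 2 + 2 * k₁ * k₃) * ((R * r) ^ 4 / 176) + k₃ ^ 2 * ((R * r) ^ 6 * 5 / 4576) := by
    intro R k₀ k₁ k₂ k₃ hR hz
    refine sphereAvg_eq hR.le hr hx _ _ (2 * k₀ * k₁) _ (2 * k₀ * k₃ + 2 * k₁ * k₂) _
      (2 * k₂ * k₃) _ fun z hzR => ?_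
    rw [map_pow, hz z hzR]
    ring
  rw [key r (1 / W - 12 * r ^ 4 / A₂) (22 / (W * r ^ 2) - 286 * r ^ 4 / A₃) (264 / A₂)
      (2288 / A₃) hr, key r' (-12 * r ^ 2 * r' ^ 2 / A₂) (-286 * r ^ 2 * r' ^ 2 / A₃) (264 / A₂)
      (2288 / A₃) hr']
  · have h₂ : (W * r ^ 4 + W' * r' ^ 4) / A₂ = 1 := by rw [← hA₂, div_self hA₂0]
    have h₃ : (W * r ^ 6 + W' * r' ^ 6) / A₃ = 1 := by rw [← hA₃, div_self hA₃0]
    have e : W * ((1 / W - 12 * r ^ 4 / A₂) ^ 2 + ((22 / (W * r ^ 2) - 286 * r ^ 4 / A₃) ^ 2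
        + 2 * (1 / W - 12 * r ^ 4 / A₂) * (264 / A₂)) * ((r * r) ^ 2 / 22)
        + ((264 / A₂) ^ 2 + 2 * (22 / (W * r ^ 2) - 286 * r ^ 4 / A₃) * (2288 / A₃))
          * ((r * r) ^ 4 / 176) + (2288 / A₃) ^ 2 * ((r * r) ^ 6 * 5 / 4576))
        = 23 / W + 252 * r ^ 4 / A₂ * (W * r ^ 4 / A₂)
          + 2002 * r ^ 6 / A₃ * (W * r ^ 6 / A₃) := by
      field_simp
      ring
    have e' : W' * ((-12 * r ^ 2 * r' ^ 2 / A₂) ^ 2 + ((-286 * r ^ 2 * r' ^ 2 / A₃) ^ 2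
        + 2 * (-12 * r ^ 2 * r' ^ 2 / A₂) * (264 / A₂)) * ((r' * r) ^ 2 / 22)
        + ((264 / A₂) ^ 2 + 2 * (-286 * r ^ 2 * r' ^ 2 / A₃) * (2288 / A₃))
          * ((r' * r) ^ 4 / 176) + (2288 / A₃) ^ 2 * ((r' * r) ^ 6 * 5 / 4576))
        = 252 * r ^ 4 / A₂ * (W' * r' ^ 4 / A₂) + 2002 * r ^ 6 / A₃ * (W' * r' ^ 6 / A₃) := by
      field_simp
      ring
    rw [e, e']
    linear_combination (252 * r ^ 4 / A₂) * h₂ + (2002 * r ^ 6 / A₃) * h₃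
  · intro z hz
    rw [eval_kernelPoly, hz]
    field_simp
    ring
  · intro z hz
    rw [eval_kernelPoly, hz]
    field_simp
    ring

lemma eval_kernelPoly_self {r r' W : ℝ} (hr : 0 < r) (hr' : 0 < r') (hne : r ≠ r')
    (hW : 0 < W) {x : EuclideanSpace ℝ (Fin 22)} (hx : ‖x‖ = r) (A₂ A₃ : ℝ) :
    eval (x : Fin 22 → ℝ) (kernelPoly (r ^ 2) (r' ^ 2) W A₂ A₃ x)
      = 23 / W + 252 * r ^ 4 / A₂ + 2002 * r ^ 6 / A₃ := by
  have hd : r ^ 2 - r' ^ 2 ≠ 0 := by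
    rw [sq_sub_sq]
    exact mul_ne_zero (by positivity) (sub_ne_zero.2 hne)
  rw [eval_kernelPoly, real_inner_self_eq_norm_sq, hx]
  field_simp
  ring

/-- A kernel on a finite set of as many points as its weighted trace, which reproduces its own
diagonal, is diagonal. -/
lemma kernel_diagonal_of_trace_eq_card {α : Type*} {X : Finset α} {w : α → ℝ}
    (hw : ∀ x ∈ X, 0 < w x) (K : α → α → ℝ)
    (hrep : ∀ x ∈ X, ∑ z ∈ X, w z * K x z ^ 2 = K x x)
    (htr : ∑ x ∈ X, w x * K x x = X.card) :
    (∀ x ∈ X, w x * K x x = 1) ∧ ∀ x ∈ X, ∀ z ∈ X, x ≠ z → K x z = 0 := by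
  have hsplit : ∀ x ∈ X, w x * K x x ^ 2 + ∑ z ∈ X.erase x, w z * K x z ^ 2 = K x x :=
    fun x hx => (Finset.add_sum_erase X (fun z => w z * K x z ^ 2) hx).trans (hrep x hx)
  have hnonneg : ∀ x, ∀ z ∈ X.erase x, 0 ≤ w z * K x z ^ 2 := fun x z hz =>
    mul_nonneg (hw z (Finset.mem_of_mem_erase hz)).le (sq_nonneg _)
  have hle : ∀ x ∈ X, 0 ≤ 1 - w x * K x x := fun x hx => by
    have h1 := hsplit x hx
    have h2 := Finset.sum_nonneg (hnonneg x)
    have h3 := mul_le_mul_of_nonneg_left (show w x * K x x ^ 2 ≤ K x x by linarith) (hw x hx).le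
    nlinarith
  have hone : ∀ x ∈ X, w x * K x x = 1 := fun x hx => by
    have h : ∑ x ∈ X, (1 - w x * K x x) = 0 := by
      rw [Finset.sum_sub_distrib, htr]; simp
    linarith [(Finset.sum_eq_zero_iff_of_nonneg hle).1 h x hx]
  refine ⟨hone, fun x hx z hz hxz => ?_⟩
  have h0 : ∑ z ∈ X.erase x, w z * K x z ^ 2 = 0 := by
    have h1 := hsplit x hx
    linear_combination h1 - K x x * hone x hx
  have := (Finset.sum_eq_zero_iff_of_nonneg (hnonneg x)).1 h0 z
    (Finset.mem_erase.2 ⟨hxz.symm, hz⟩)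
  simpa [(hw z hz).ne'] using this

section Design

variable {X₁ X₂ : Finset (EuclideanSpace ℝ (Fin 22))} {w : EuclideanSpace ℝ (Fin 22) → ℝ}
  {r₁ r₂ : ℝ}

/-- First and second directional moments of a fiber of a two-sphere design. -/
lemma IsEuclideanDesignTwoSpheres.fiber_sum (hr₁ : 0 < r₁) (hr₂ : 0 < r₂) (hrne : r₁ ≠ r₂)
    (hX₁ : ∀ x ∈ X₁, ‖x‖ = r₁) (hX₂ : ∀ x ∈ X₂, ‖x‖ = r₂)
    (h : IsEuclideanDesignTwoSpheres 6 X₁ X₂ w r₁ r₂) {y : EuclideanSpace ℝ (Fin 22)}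
    {s : ℝ} (hs : 0 < s) (hy : ‖y‖ = s) :
    ∑ x ∈ X₁, w x * inner ℝ y x = 0 ∧
      ∑ x ∈ X₁, w x * inner ℝ y x ^ 2 = (∑ x ∈ X₁, w x) * ((r₁ * s) ^ 2 / 22) := by
  have hd : r₁ ^ 2 - r₂ ^ 2 ≠ 0 := by
    rw [sq_sub_sq]
    exact mul_ne_zero (by positivity) (sub_ne_zero.2 hrne)
  have hdisj : Disjoint X₁ X₂ := Finset.disjoint_left.2 fun x h1 h2 =>
    hrne ((hX₁ x h1).symm.trans (hX₂ x h2))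
  have key : ∀ k : ℕ, k ≤ 2 → (∑ x ∈ X₁, w x)
      * sphereAvg 22 r₁ ((normSqPoly 22 - C (r₂ ^ 2)) * linForm y ^ k)
      = (r₁ ^ 2 - r₂ ^ 2) * ∑ x ∈ X₁, w x * inner ℝ y x ^ k := fun k hk => by
    have hdeg : ((normSqPoly 22 - C (r₂ ^ 2)) * linForm y ^ k).totalDegree ≤ 6 := by
      have h1 := totalDegree_normSqPoly_sub_C_le 22 (r₂ ^ 2)
      have h2 := totalDegree_pow (linForm y) k
      have h3 := Nat.mul_le_mul_left k (totalDegree_linForm_le y)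
      have h4 := totalDegree_mul (normSqPoly 22 - C (r₂ ^ 2)) (linForm y ^ k)
      omega
    have h0 : sphereAvg 22 r₂ ((normSqPoly 22 - C (r₂ ^ 2)) * linForm y ^ k) = 0 := by
      rw [sphereAvg_eq hr₂.le hs hy _ 0 0 0 0 0 0 0 fun z hz => ?_]
      · ring
      · simp only [map_mul, map_sub, eval_C, eval_normSqPoly, hz]
        ring
    have h1 := h _ hdeg
    rw [h0, mul_zero, add_zero, Finset.sum_union hdisj] at h1
    rw [h1, Finset.mul_sum, Finset.sum_eq_zero (s := X₂), add_zero]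
    · refine Finset.sum_congr rfl fun x hx => ?_
      simp only [map_mul, map_sub, map_pow, eval_C, eval_normSqPoly, eval_linForm, hX₁ x hx]
      ring
    · intro x hx
      simp only [map_mul, map_sub, eval_C, eval_normSqPoly, hX₂ x hx]
      ring
  constructor
  · have := key 1 (by norm_num)
    rw [sphereAvg_eq hr₁.le hs hy _ 0 (r₁ ^ 2 - r₂ ^ 2) 0 0 0 0 0 fun z hz => ?_] at this
    · simp only [pow_one] at this
      have h0 : (r₁ ^ 2 - r₂ ^ 2) * ∑ x ∈ X₁, w x * inner ℝ y x = 0 := by linarith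
      exact (mul_eq_zero.1 h0).resolve_left hd
    · simp only [map_mul, map_sub, map_pow, eval_C, eval_normSqPoly, eval_linForm, hz]
      ring
  · have := key 2 le_rfl
    rw [sphereAvg_eq hr₁.le hs hy _ 0 0 (r₁ ^ 2 - r₂ ^ 2) 0 0 0 0 fun z hz => ?_] at this
    · apply mul_left_cancel₀ hd
      linear_combination -this
    · simp only [map_mul, map_sub, map_pow, eval_C, eval_normSqPoly, eval_linForm, hz]
      ring

/-- Rigidity of tight `6`-designs on two spheres in `ℝ²²`. -/
lemma IsEuclideanDesignTwoSpheres.tight (hr₁ : 0 < r₁) (hr₂ : 0 < r₂) (hrne : r₁ ≠ r₂)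
    (hX₁ : ∀ x ∈ X₁, ‖x‖ = r₁) (hX₂ : ∀ x ∈ X₂, ‖x‖ = r₂)
    (hw : ∀ x ∈ X₁ ∪ X₂, 0 < w x) (hcard : (X₁ ∪ X₂).card = 2300)
    (h : IsEuclideanDesignTwoSpheres 6 X₁ X₂ w r₁ r₂) {W₁ W₂ A₂ A₃ : ℝ}
    (hW₁ : W₁ = ∑ x ∈ X₁, w x) (hW₂ : W₂ = ∑ x ∈ X₂, w x) (hW₁0 : 0 < W₁) (hW₂0 : 0 < W₂)
    (hA₂ : A₂ = W₁ * r₁ ^ 4 + W₂ * r₂ ^ 4) (hA₃ : A₃ = W₁ * r₁ ^ 6 + W₂ * r₂ ^ 6) :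
    (∀ x ∈ X₁, w x * (23 / W₁ + 252 * r₁ ^ 4 / A₂ + 2002 * r₁ ^ 6 / A₃) = 1) ∧
      (∀ x ∈ X₂, w x * (23 / W₂ + 252 * r₂ ^ 4 / A₂ + 2002 * r₂ ^ 6 / A₃) = 1) ∧
      ∀ x ∈ X₁, ∀ y ∈ X₂, 12 / A₂ * (22 * inner ℝ x y ^ 2 - r₁ ^ 2 * r₂ ^ 2)
        + 286 / A₃ * (inner ℝ x y * (8 * inner ℝ x y ^ 2 - r₁ ^ 2 * r₂ ^ 2)) = 0 := by
  have hdisj : Disjoint X₁ X₂ := Finset.disjoint_left.2 fun x h1 h2 =>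
    hrne ((hX₁ x h1).symm.trans (hX₂ x h2))
  have hA₂0 : A₂ ≠ 0 := by rw [hA₂]; positivity
  have hA₃0 : A₃ ≠ 0 := by rw [hA₃]; positivity
  let K : EuclideanSpace ℝ (Fin 22) → EuclideanSpace ℝ (Fin 22) → ℝ := fun x z =>
    eval (z : Fin 22 → ℝ) (if x ∈ X₁ then kernelPoly (r₁ ^ 2) (r₂ ^ 2) W₁ A₂ A₃ x
      else kernelPoly (r₂ ^ 2) (r₁ ^ 2) W₂ A₂ A₃ x)
  have hK₁ : ∀ x ∈ X₁, K x = fun z : EuclideanSpace ℝ (Fin 22) =>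
      eval (z : Fin 22 → ℝ) (kernelPoly (r₁ ^ 2) (r₂ ^ 2) W₁ A₂ A₃ x) := fun x hx => by
    simp only [K, if_pos hx]
  have hK₂ : ∀ x ∈ X₂, K x = fun z : EuclideanSpace ℝ (Fin 22) =>
      eval (z : Fin 22 → ℝ) (kernelPoly (r₂ ^ 2) (r₁ ^ 2) W₂ A₂ A₃ x) := fun x hx => by
    simp only [K, if_neg (Finset.disjoint_right.1 hdisj hx)]
  have hd₁ : ∀ x ∈ X₁, K x x = 23 / W₁ + 252 * r₁ ^ 4 / A₂ + 2002 * r₁ ^ 6 / A₃ := fun x hx => by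
    rw [hK₁ x hx]
    exact eval_kernelPoly_self hr₁ hr₂ hrne hW₁0 (hX₁ x hx) _ _
  have hd₂ : ∀ x ∈ X₂, K x x = 23 / W₂ + 252 * r₂ ^ 4 / A₂ + 2002 * r₂ ^ 6 / A₃ := fun x hx => by
    rw [hK₂ x hx]
    exact eval_kernelPoly_self hr₂ hr₁ hrne.symm hW₂0 (hX₂ x hx) _ _
  have hdeg : ∀ (ρ ρ' W : ℝ) (x : EuclideanSpace ℝ (Fin 22)),
      (kernelPoly ρ ρ' W A₂ A₃ x ^ 2).totalDegree ≤ 6 := fun ρ ρ' W x => by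
    have h1 := totalDegree_pow (kernelPoly ρ ρ' W A₂ A₃ x) 2
    have h2 := totalDegree_kernelPoly_le ρ ρ' W A₂ A₃ x
    omega
  obtain ⟨hone, hzero⟩ := kernel_diagonal_of_trace_eq_card hw K (fun x hx => by
    rcases Finset.mem_union.1 hx with hx | hx
    · rw [hd₁ x hx, hK₁ x hx, ← sphereAvg_kernelPoly_sq hr₁ hr₂ hrne hW₁0 hW₂0 (hX₁ x hx) hA₂ hA₃,
        hW₁, hW₂, h _ (hdeg _ _ _ _)]
      simp only [map_pow]
    · rw [hd₂ x hx, hK₂ x hx, ← sphereAvg_kernelPoly_sq hr₂ hr₁ hrne.symm hW₂0 hW₁0 (hX₂ x hx)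
        (hA₂.trans (add_comm _ _)) (hA₃.trans (add_comm _ _)),
        hW₁, hW₂, h.symm _ (hdeg _ _ _ _), Finset.union_comm]
      simp only [map_pow]) (by
    rw [Finset.sum_union hdisj, Finset.sum_congr rfl fun x hx => by rw [hd₁ x hx],
      Finset.sum_congr (s₁ := X₂) rfl fun x hx => by rw [hd₂ x hx], ← Finset.sum_mul,
      ← Finset.sum_mul, ← hW₁, ← hW₂, hcard]
    have h₂ : (W₁ * r₁ ^ 4 + W₂ * r₂ ^ 4) / A₂ = 1 := by rw [← hA₂, div_self hA₂0]
    have h₃ : (W₁ * r₁ ^ 6 + W₂ * r₂ ^ 6) / A₃ = 1 := by rw [← hA₃, div_self hA₃0]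
    have h₄ : W₁ / W₁ = 1 := div_self hW₁0.ne'
    have h₅ : W₂ / W₂ = 1 := div_self hW₂0.ne'
    push_cast
    linear_combination 252 * h₂ + 2002 * h₃ + 23 * h₄ + 23 * h₅)
  refine ⟨fun x hx => ?_, fun x hx => ?_, fun x hx y hy => ?_⟩
  · rw [← hd₁ x hx]
    exact hone x (Finset.mem_union_left _ hx)
  · rw [← hd₂ x hx]
    exact hone x (Finset.mem_union_right _ hx)
  · have := hzero x (Finset.mem_union_left _ hx) y (Finset.mem_union_right _ hy)
      fun hxy => Finset.disjoint_left.1 hdisj hx (hxy ▸ hy)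
    rw [hK₁ x hx] at this
    beta_reduce at this
    rw [eval_kernelPoly, hX₂ y hy] at this
    linear_combination this

end Design

/-- In a finite family with mean `0` and variance `1` taking values in the roots of a cubic, the
multiplicity of a root `s`. -/
lemma card_filter_eq_of_cubic {α : Type*} (X : Finset α) (τ : α → ℝ) {B s : ℝ}
    (h₁ : ∑ x ∈ X, τ x = 0) (h₂ : ∑ x ∈ X, τ x ^ 2 = X.card)
    (hτ : ∀ x ∈ X, τ x ^ 3 + B * τ x ^ 2 - 11 / 4 * τ x - B = 0)
    (hs : s ^ 3 + B * s ^ 2 - 11 / 4 * s - B = 0) :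
    ({x ∈ X | τ x = s}.card : ℝ) * (4 * s ^ 4 - s ^ 2 + 11) = 7 * X.card := by
  have hq : ∀ x ∈ X, τ x ^ 2 + (B + s) * τ x + (s ^ 2 + B * s - 11 / 4)
      = if τ x = s then 3 * s ^ 2 + 2 * B * s - 11 / 4 else 0 := fun x hx => by
    split_ifs with h
    · rw [h]; ring
    · apply mul_left_cancel₀ (sub_ne_zero.2 h)
      linear_combination hτ x hx - hs
  have hsum := Finset.sum_congr rfl hq
  rw [Finset.sum_add_distrib, Finset.sum_add_distrib, ← Finset.mul_sum, h₁, h₂, Finset.sum_const,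
    ← Finset.sum_filter, Finset.sum_const, nsmul_eq_mul, nsmul_eq_mul] at hsum
  linear_combination (-4 * (s ^ 2 - 1)) * hsum
    + (4 * s * X.card - 8 * s * ({x ∈ X | τ x = s}.card : ℝ)) * hs

lemma exists_roots_cubic {B : ℝ} (hB : 0 < B) : ∃ s₁ s₂ s₃ : ℝ,
    s₁ + s₂ + s₃ = -B ∧ s₁ * s₂ + s₁ * s₃ + s₂ * s₃ = -(11 / 4) ∧ s₁ * s₂ * s₃ = B ∧
    ∀ s ∈ [s₁, s₂, s₃], s ^ 3 + B * s ^ 2 - 11 / 4 * s - B = 0 := by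
  let P : ℝ → ℝ := fun s => s ^ 3 + B * s ^ 2 - 11 / 4 * s - B
  have hP : Continuous P := by fun_prop
  obtain ⟨s₁, ⟨-, h1⟩, hs₁⟩ := intermediate_value_Ioo (show -(B + 2) ≤ -1 by linarith)
    hP.continuousOn (show (0 : ℝ) ∈ Set.Ioo _ _ by
      constructor <;> simp only [P] <;> nlinarith)
  obtain ⟨s₂, ⟨h2, h2'⟩, hs₂⟩ := intermediate_value_Ioo' (show (-1 : ℝ) ≤ 1 by norm_num)
    hP.continuousOn (show (0 : ℝ) ∈ Set.Ioo _ _ by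
      constructor <;> simp only [P] <;> nlinarith)
  obtain ⟨s₃, ⟨h3, -⟩, hs₃⟩ := intermediate_value_Ioo (show (1 : ℝ) ≤ 2 by norm_num)
    hP.continuousOn (show (0 : ℝ) ∈ Set.Ioo _ _ by
      constructor <;> simp only [P] <;> nlinarith)
  simp only [P] at hs₁ hs₂ hs₃
  have h12 : s₁ - s₂ ≠ 0 := by linarith
  have h13 : s₁ - s₃ ≠ 0 := by linarith
  have h23 : s₂ - s₃ ≠ 0 := by linarith
  have d12 : s₁ ^ 2 + s₁ * s₂ + s₂ ^ 2 + B * (s₁ + s₂) - 11 / 4 = 0 := by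
    apply mul_left_cancel₀ h12
    linear_combination hs₁ - hs₂
  have d13 : s₁ ^ 2 + s₁ * s₃ + s₃ ^ 2 + B * (s₁ + s₃) - 11 / 4 = 0 := by
    apply mul_left_cancel₀ h13
    linear_combination hs₁ - hs₃
  have e1 : s₁ + s₂ + s₃ = -B := by
    apply mul_left_cancel₀ h23
    linear_combination d12 - d13
  have e2 : s₁ * s₂ + s₁ * s₃ + s₂ * s₃ = -(11 / 4) := by
    linear_combination -d12 + (s₁ + s₂) * e1
  refine ⟨s₁, s₂, s₃, e1, e2, ?_, ?_⟩
  · linear_combination hs₁ + s₁ * e2 - s₁ ^ 2 * e1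
  · simp [hs₁, hs₂, hs₃]

lemma int_multiplicities : ∀ a ∈ Finset.Icc 1 23, ∀ b ∈ Finset.Icc 1 23, a + b < 25 →
    4 * (77 * (a * b * (25 - a - b)) + 437500 - 2800 * (a * b + (a + b) * (25 - a - b))) ^ 2
      + 27 * 49 * (a * b * (25 - a - b))
        * (77 * (a * b * (25 - a - b)) + 437500 - 2800 * (a * b + (a + b) * (25 - a - b)))
      + 88 * (49 * (a * b * (25 - a - b))) ^ 2
      = 175 * 49 ^ 2 * (a * b + (a + b) * (25 - a - b)) * (a * b * (25 - a - b)) →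
    a * b * (25 - a - b) = (224 : ℤ) ∧ a * b + (a + b) * (25 - a - b) = 158 := by
  decide +kernel

/-- Integrality of the multiplicities determines the cubic. -/
lemma sq_eq_of_multiplicities {B s₁ s₂ s₃ : ℝ} {k₁ k₂ k₃ : ℕ}
    (h₁ : s₁ + s₂ + s₃ = -B) (h₂ : s₁ * s₂ + s₁ * s₃ + s₂ * s₃ = -(11 / 4))
    (h₃ : s₁ * s₂ * s₃ = B) (hk₁ : k₁ * (4 * s₁ ^ 4 - s₁ ^ 2 + 11) = 175)
    (hk₂ : k₂ * (4 * s₂ ^ 4 - s₂ ^ 2 + 11) = 175)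
    (hk₃ : k₃ * (4 * s₃ ^ 4 - s₃ ^ 2 + 11) = 175) : B ^ 2 = 9 / 8 := by
  set v := B ^ 2 with hv
  have p₁ : s₁ ^ 2 + s₂ ^ 2 + s₃ ^ 2 = v + 11 / 2 := by
    have : s₁ ^ 2 + s₂ ^ 2 + s₃ ^ 2
      = (s₁ + s₂ + s₃) ^ 2 - 2 * (s₁ * s₂ + s₁ * s₃ + s₂ * s₃) := by ring
    rw [this, h₁, h₂]; ring
  have p₂ : s₁ ^ 2 * s₂ ^ 2 + s₁ ^ 2 * s₃ ^ 2 + s₂ ^ 2 * s₃ ^ 2 = 121 / 16 + 2 * v := by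
    have : s₁ ^ 2 * s₂ ^ 2 + s₁ ^ 2 * s₃ ^ 2 + s₂ ^ 2 * s₃ ^ 2
      = (s₁ * s₂ + s₁ * s₃ + s₂ * s₃) ^ 2 - 2 * (s₁ + s₂ + s₃) * (s₁ * s₂ * s₃) := by ring
    rw [this, h₁, h₂, h₃]; ring
  have p₃ : s₁ ^ 2 * s₂ ^ 2 * s₃ ^ 2 = v := by
    rw [← mul_pow, ← mul_pow, h₃]
  have hv0 : 0 ≤ v := sq_nonneg _
  clear_value v
  have hu : ∀ s : ℝ, 4 * s ^ 4 - s ^ 2 + 11 = 4 * (s ^ 2) ^ 2 - s ^ 2 + 11 := fun s => by ring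
  rw [hu] at hk₁ hk₂ hk₃
  generalize s₁ ^ 2 = u₁ at *
  generalize s₂ ^ 2 = u₂ at *
  generalize s₃ ^ 2 = u₃ at *
  obtain ⟨g₁, hg₁⟩ : ∃ g, g = 4 * u₁ ^ 2 - u₁ + 11 := ⟨_, rfl⟩
  obtain ⟨g₂, hg₂⟩ : ∃ g, g = 4 * u₂ ^ 2 - u₂ + 11 := ⟨_, rfl⟩
  obtain ⟨g₃, hg₃⟩ : ∃ g, g = 4 * u₃ ^ 2 - u₃ + 11 := ⟨_, rfl⟩
  have G₁ : g₁ + g₂ + g₃ = 4 * v ^ 2 + 27 * v + 88 := by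
    have : g₁ + g₂ + g₃ = 4 * ((u₁ + u₂ + u₃) ^ 2 - 2 * (u₁ * u₂ + u₁ * u₃ + u₂ * u₃))
        - (u₁ + u₂ + u₃) + 33 := by rw [hg₁, hg₂, hg₃]; ring
    rw [this, p₁, p₂]; ring
  have G₃ : g₁ * g₂ * g₃ = 784 * v ^ 2 + 23569 / 4 * v + 65219 / 4 := by
    have : g₁ * g₂ * g₃ = 64 * (u₁ * u₂ * u₃) ^ 2
        - 16 * (u₁ * u₂ * u₃) * (u₁ * u₂ + u₁ * u₃ + u₂ * u₃)
        + 176 * ((u₁ * u₂ + u₁ * u₃ + u₂ * u₃) ^ 2 - 2 * (u₁ + u₂ + u₃) * (u₁ * u₂ * u₃))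
        + 4 * (u₁ * u₂ * u₃) * (u₁ + u₂ + u₃)
        - 44 * ((u₁ + u₂ + u₃) * (u₁ * u₂ + u₁ * u₃ + u₂ * u₃) - 3 * (u₁ * u₂ * u₃))
        + 484 * ((u₁ + u₂ + u₃) ^ 2 - 2 * (u₁ * u₂ + u₁ * u₃ + u₂ * u₃))
        - u₁ * u₂ * u₃ + 11 * (u₁ * u₂ + u₁ * u₃ + u₂ * u₃) - 121 * (u₁ + u₂ + u₃) + 1331 := by
      rw [hg₁, hg₂, hg₃]; ring
    rw [this, p₁, p₂, p₃]; ring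
  have G₂ : 7 * (g₁ * g₂ + g₁ * g₃ + g₂ * g₃) = g₁ * g₂ * g₃ := by
    have : g₁ * g₂ + g₁ * g₃ + g₂ * g₃
        = 16 * ((u₁ * u₂ + u₁ * u₃ + u₂ * u₃) ^ 2 - 2 * (u₁ + u₂ + u₃) * (u₁ * u₂ * u₃))
        - 4 * ((u₁ + u₂ + u₃) * (u₁ * u₂ + u₁ * u₃ + u₂ * u₃) - 3 * (u₁ * u₂ * u₃))
        + 88 * ((u₁ + u₂ + u₃) ^ 2 - 2 * (u₁ * u₂ + u₁ * u₃ + u₂ * u₃))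
        + (u₁ * u₂ + u₁ * u₃ + u₂ * u₃) - 22 * (u₁ + u₂ + u₃) + 363 := by
      rw [hg₁, hg₂, hg₃]; ring
    rw [G₃, this, p₁, p₂, p₃]; ring
  rw [← hg₁] at hk₁
  rw [← hg₂] at hk₂
  rw [← hg₃] at hk₃
  have hG₃ : g₁ * g₂ * g₃ ≠ 0 := by rw [G₃]; positivity
  have hsum : (k₁ + k₂ + k₃ : ℝ) = 25 := by
    apply mul_right_cancel₀ hG₃
    linear_combination g₂ * g₃ * hk₁ + g₁ * g₃ * hk₂ + g₁ * g₂ * hk₃ + 25 * G₂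
  have hP : (k₁ * k₂ * k₃ : ℝ) * (4 * v ^ 2 + 27 * v + 88)
      = 175 * (k₁ * k₂ + k₁ * k₃ + k₂ * k₃) := by
    rw [← G₁]
    linear_combination k₂ * k₃ * hk₁ + k₁ * k₃ * hk₂ + k₁ * k₂ * hk₃
  have hV : 49 * v * (k₁ * k₂ * k₃ : ℝ)
      = 77 * (k₁ * k₂ * k₃) + 437500 - 2800 * (k₁ * k₂ + k₁ * k₃ + k₂ * k₃) := by
    have hk : (k₁ * k₂ * k₃ : ℝ) * (g₁ * g₂ * g₃) = 175 ^ 3 := by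
      linear_combination k₂ * g₂ * k₃ * g₃ * hk₁ + 175 * (k₃ * g₃) * hk₂ + 175 ^ 2 * hk₃
    rw [G₃] at hk
    linear_combination 4 / 49 * hk - 16 * hP
  have pos : ∀ {k : ℕ} {g : ℝ}, k * g = 175 → 1 ≤ k := fun {k g} h => by
    rw [Nat.one_le_iff_ne_zero]
    rintro rfl
    norm_num at h
  have hsum' : k₁ + k₂ + k₃ = 25 := by exact_mod_cast hsum
  have q₁ := pos hk₁
  have q₂ := pos hk₂
  have q₃ := pos hk₃
  have hk₃' : (k₃ : ℤ) = 25 - k₁ - k₂ := by omega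
  have key := int_multiplicities k₁ (Finset.mem_Icc.2 ⟨by omega, by omega⟩) k₂
    (Finset.mem_Icc.2 ⟨by omega, by omega⟩) (by omega)
  rw [← hk₃'] at key
  obtain ⟨r₁, r₂⟩ := key (by
    have : ((4 * (77 * (k₁ * k₂ * k₃) + 437500 - 2800 * (k₁ * k₂ + (k₁ + k₂) * k₃)) ^ 2
      + 27 * 49 * (k₁ * k₂ * k₃)
        * (77 * (k₁ * k₂ * k₃) + 437500 - 2800 * (k₁ * k₂ + (k₁ + k₂) * k₃))
      + 88 * (49 * (k₁ * k₂ * k₃)) ^ 2 : ℤ) : ℝ)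
      = ((175 * 49 ^ 2 * (k₁ * k₂ + (k₁ + k₂) * k₃) * (k₁ * k₂ * k₃) : ℤ) : ℝ) := by
      push_cast
      rw [show (k₁ * k₂ + (k₁ + k₂) * k₃ : ℝ) = k₁ * k₂ + k₁ * k₃ + k₂ * k₃ by ring, ← hV]
      linear_combination 49 ^ 2 * (k₁ * k₂ * k₃ : ℝ) * hP
    exact_mod_cast this)
  have r₁' : (k₁ * k₂ * k₃ : ℝ) = 224 := by exact_mod_cast r₁
  have r₂' : (k₁ * k₂ + (k₁ + k₂) * k₃ : ℝ) = 158 := by exact_mod_cast r₂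
  rw [r₁', show (k₁ * k₂ + k₁ * k₃ + k₂ * k₃ : ℝ) = 158 by linarith] at hV
  linarith

/-- The radius and total weight ratios are determined by the diagonal and mixed equations. -/
lemma ratios_eq {r₁ r₂ W₁ W₂ A₂ A₃ : ℝ} (hr₁ : 0 < r₁) (hr₂ : 0 < r₂) (hW₁ : 0 < W₁)
    (hW₂ : 0 < W₂) (hA₂ : A₂ = W₁ * r₁ ^ 4 + W₂ * r₂ ^ 4)
    (hA₃ : A₃ = W₁ * r₁ ^ 6 + W₂ * r₂ ^ 6)
    (hdiag : W₁ * (252 * r₁ ^ 4 / A₂ + 2002 * r₁ ^ 6 / A₃) = 252)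
    (hmix : 44 * A₃ ^ 2 = 169 * A₂ ^ 2 * (r₁ * r₂) ^ 2) :
    r₂ ^ 2 = 11 * r₁ ^ 2 ∧ W₂ / W₁ = 1 / 99 := by
  obtain ⟨R, hR⟩ : ∃ R, R = r₂ ^ 2 / r₁ ^ 2 := ⟨_, rfl⟩
  obtain ⟨p, hp⟩ : ∃ p, p = W₂ / W₁ := ⟨_, rfl⟩
  have hR0 : 0 < R := by rw [hR]; positivity
  have hp0 : 0 < p := by rw [hp]; positivity
  have hr : r₂ ^ 2 = R * r₁ ^ 2 := by rw [hR]; field_simp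
  have hW : W₂ = p * W₁ := by rw [hp]; field_simp
  have hA₂' : A₂ = W₁ * r₁ ^ 4 * (1 + p * R ^ 2) := by
    rw [hA₂, hW, show r₂ ^ 4 = (r₂ ^ 2) ^ 2 by ring, hr]; ring
  have hA₃' : A₃ = W₁ * r₁ ^ 6 * (1 + p * R ^ 3) := by
    rw [hA₃, hW, show r₂ ^ 6 = (r₂ ^ 2) ^ 3 by ring, hr]; ring
  have e₁ : 143 * (1 + p * R ^ 2) = 18 * (p * R ^ 2) * (1 + p * R ^ 3) := by
    rw [hA₂', hA₃'] at hdiag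
    field_simp at hdiag
    linarith
  have e₂ : 44 * (1 + p * R ^ 3) ^ 2 = 169 * (1 + p * R ^ 2) ^ 2 * R := by
    rw [mul_pow r₁, hr, hA₂', hA₃'] at hmix
    have : W₁ ^ 2 * r₁ ^ 12 ≠ 0 := by positivity
    apply mul_left_cancel₀ this
    linear_combination hmix
  have e₃ : 143 ^ 2 * 44 = 18 ^ 2 * 169 * (p * R ^ 2) ^ 2 * R := by
    have : (1 + p * R ^ 2) ^ 2 ≠ 0 := by positivity
    apply mul_left_cancel₀ this
    linear_combination 44 * (143 * (1 + p * R ^ 2) + 18 * (p * R ^ 2) * (1 + p * R ^ 3)) * e₁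
      + 18 ^ 2 * (p * R ^ 2) ^ 2 * e₂
  have e₄ : p * R ^ 2 = 11 / 9 := by
    linear_combination (-1 / (18 * 169 * 125)) * (e₃ - 18 * 169 * e₁)
  have e₅ : R = 11 := by
    rw [e₄] at e₃
    linarith
  rw [e₅] at e₄ hr
  exact ⟨hr, by rw [← hp]; linarith⟩

/-- the weight is constant on each fiber, `r₂/r₁ = √11` and `w₂/w₁ = 1/729`. -/
theorem statement5
    {X₁ X₂ : Finset (EuclideanSpace ℝ (Fin 22))} {w : EuclideanSpace ℝ (Fin 22) → ℝ}
    {r₁ r₂ : ℝ} (hr₁ : 0 < r₁) (hr₂ : 0 < r₂) (hrne : r₁ ≠ r₂)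
    (hX₁ : ∀ x ∈ X₁, ‖x‖ = r₁) (hX₂ : ∀ x ∈ X₂, ‖x‖ = r₂)
    (hw : ∀ x ∈ X₁ ∪ X₂, 0 < w x)
    (hcard : (X₁ ∪ X₂).card = 2300) (hcard₁ : X₁.card = 275)
    (hdesign : IsEuclideanDesignTwoSpheres 6 X₁ X₂ w r₁ r₂) :
    ∃ w₁ w₂ : ℝ, 0 < w₁ ∧ 0 < w₂ ∧ (∀ x ∈ X₁, w x = w₁) ∧ (∀ x ∈ X₂, w x = w₂) ∧
      r₂ / r₁ = Real.sqrt 11 ∧ w₂ / w₁ = 1 / 729 := by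
  have hdisj : Disjoint X₁ X₂ := Finset.disjoint_left.2 fun x h1 h2 =>
    hrne ((hX₁ x h1).symm.trans (hX₂ x h2))
  have hcard₂ : X₂.card = 2025 := by
    rw [Finset.card_union_of_disjoint hdisj] at hcard
    omega
  have hne₁ : X₁.Nonempty := Finset.card_pos.1 (by omega)
  have hne₂ : X₂.Nonempty := Finset.card_pos.1 (by omega)
  obtain ⟨W₁, hW₁⟩ : ∃ W, W = ∑ x ∈ X₁, w x := ⟨_, rfl⟩
  obtain ⟨W₂, hW₂⟩ : ∃ W, W = ∑ x ∈ X₂, w x := ⟨_, rfl⟩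
  have hW₁0 : 0 < W₁ := hW₁ ▸ Finset.sum_pos (fun x hx => hw x (Finset.mem_union_left _ hx)) hne₁
  have hW₂0 : 0 < W₂ := hW₂ ▸ Finset.sum_pos (fun x hx => hw x (Finset.mem_union_right _ hx)) hne₂
  obtain ⟨A₂, hA₂⟩ : ∃ A, A = W₁ * r₁ ^ 4 + W₂ * r₂ ^ 4 := ⟨_, rfl⟩
  obtain ⟨A₃, hA₃⟩ : ∃ A, A = W₁ * r₁ ^ 6 + W₂ * r₂ ^ 6 := ⟨_, rfl⟩
  have hA₂0 : 0 < A₂ := by rw [hA₂]; positivity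
  have hA₃0 : 0 < A₃ := by rw [hA₃]; positivity
  obtain ⟨hd₁, hd₂, hmix⟩ := hdesign.tight hr₁ hr₂ hrne hX₁ hX₂ hw hcard hW₁ hW₂ hW₁0 hW₂0 hA₂ hA₃
  obtain ⟨x₀, hx₀⟩ := hne₁
  obtain ⟨y₀, hy₀⟩ := hne₂
  obtain ⟨w₁, hw₁⟩ : ∃ c, c = w x₀ := ⟨_, rfl⟩
  obtain ⟨w₂, hw₂⟩ : ∃ c, c = w y₀ := ⟨_, rfl⟩
  have hw₁0 : 0 < w₁ := hw₁ ▸ hw x₀ (Finset.mem_union_left _ hx₀)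
  have hw₂0 : 0 < w₂ := hw₂ ▸ hw y₀ (Finset.mem_union_right _ hy₀)
  have hc₁ : ∀ x ∈ X₁, w x = w₁ := fun x hx => by
    rw [hw₁]
    exact mul_right_cancel₀ (right_ne_zero_of_mul_eq_one (hd₁ x hx))
      ((hd₁ x hx).trans (hd₁ x₀ hx₀).symm)
  have hc₂ : ∀ x ∈ X₂, w x = w₂ := fun x hx => by
    rw [hw₂]
    exact mul_right_cancel₀ (right_ne_zero_of_mul_eq_one (hd₂ x hx))
      ((hd₂ x hx).trans (hd₂ y₀ hy₀).symm)
  have hW₁' : W₁ = 275 * w₁ := by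
    rw [hW₁, Finset.sum_congr rfl hc₁, Finset.sum_const, hcard₁, nsmul_eq_mul]
    norm_num
  have hW₂' : W₂ = 2025 * w₂ := by
    rw [hW₂, Finset.sum_congr rfl hc₂, Finset.sum_const, hcard₂, nsmul_eq_mul]
    norm_num
  have hdiag : W₁ * (252 * r₁ ^ 4 / A₂ + 2002 * r₁ ^ 6 / A₃) = 252 := by
    have h := hd₁ x₀ hx₀
    rw [← hw₁] at h
    have h' : W₁ * (23 / W₁) = 23 := by field_simp
    linear_combination 275 * h - h'
      + (23 / W₁ + 252 * r₁ ^ 4 / A₂ + 2002 * r₁ ^ 6 / A₃) * hW₁'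
  obtain ⟨q, hq0, hq⟩ : ∃ q : ℝ, 0 < q ∧ q ^ 2 = 22 :=
    ⟨√22, by positivity, Real.sq_sqrt (by norm_num)⟩
  obtain ⟨m, hm⟩ : ∃ m, m = r₁ * r₂ := ⟨_, rfl⟩
  have hm0 : 0 < m := by rw [hm]; positivity
  obtain ⟨B, hB⟩ : ∃ B, B = 3 * q * A₃ / (26 * A₂ * m) := ⟨_, rfl⟩
  have hB0 : 0 < B := by rw [hB]; positivity
  have hcubic : ∀ x ∈ X₁, ∀ y ∈ X₂, (q / m * inner ℝ x y) ^ 3 + B * (q / m * inner ℝ x y) ^ 2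
      - 11 / 4 * (q / m * inner ℝ x y) - B = 0 := fun x hx y hy => by
    have h := hmix x hx y hy
    rw [← mul_pow, ← hm] at h
    generalize inner ℝ x y = t at h ⊢
    have e : (q / m * t) ^ 3 + B * (q / m * t) ^ 2 - 11 / 4 * (q / m * t) - B
        = A₃ * q / (104 * m ^ 3) * (12 / A₂ * (22 * t ^ 2 - m ^ 2)
          + 286 / A₃ * (t * (8 * t ^ 2 - m ^ 2)))
          + (q * t ^ 3 / m ^ 3 + B * t ^ 2 / m ^ 2) * (q ^ 2 - 22) := by
      rw [hB]
      field_simp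
      ring
    rw [e, h, hq]
    ring
  have hfib : ∀ {X X' : Finset (EuclideanSpace ℝ (Fin 22))} {r r' c : ℝ}, 0 < r → 0 < r' → r ≠ r' →
      r * r' = m → (∀ x ∈ X, ‖x‖ = r) → (∀ x ∈ X', ‖x‖ = r') → 0 < c → (∀ x ∈ X, w x = c) →
      IsEuclideanDesignTwoSpheres 6 X X' w r r' → ∀ y ∈ X',
      ∑ x ∈ X, q / m * inner ℝ y x = 0 ∧ ∑ x ∈ X, (q / m * inner ℝ y x) ^ 2 = X.card := by
    intro X X' r r' c hr hr' hne hmr hX hX' hc hwc hdes y hy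
    obtain ⟨h1, h2⟩ := hdes.fiber_sum hr hr' hne hX hX' hr' (hX' y hy)
    rw [Finset.sum_congr rfl fun x hx => by rw [hwc x hx], ← Finset.mul_sum] at h1
    rw [Finset.sum_congr rfl fun x hx => by rw [hwc x hx], ← Finset.mul_sum,
      Finset.sum_congr rfl hwc, Finset.sum_const, nsmul_eq_mul, hmr] at h2
    constructor
    · rw [← Finset.mul_sum, (mul_eq_zero.1 h1).resolve_left hc.ne', mul_zero]
    · simp only [mul_pow]
      rw [← Finset.mul_sum, div_pow, hq]
      apply mul_left_cancel₀ hc.ne'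
      have h3 : (22 : ℝ) / m ^ 2 * (m ^ 2 / 22) = 1 := by field_simp
      linear_combination 22 / m ^ 2 * h2 + X.card * c * h3
  have hmult : ∀ s : ℝ, s ^ 3 + B * s ^ 2 - 11 / 4 * s - B = 0 →
      ∃ k : ℕ, k * (4 * s ^ 4 - s ^ 2 + 11) = 175 := fun s hs => by
    obtain ⟨a1, a2⟩ := hfib hr₁ hr₂ hrne hm.symm hX₁ hX₂ hw₁0 hc₁ hdesign y₀ hy₀
    obtain ⟨b1, b2⟩ := hfib hr₂ hr₁ hrne.symm ((mul_comm _ _).trans hm.symm) hX₂ hX₁ hw₂0 hc₂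
      hdesign.symm x₀ hx₀
    have ha := card_filter_eq_of_cubic X₁ _ a1 a2
      (fun x hx => by rw [real_inner_comm]; exact hcubic x hx y₀ hy₀) hs
    have hb := card_filter_eq_of_cubic X₂ _ b1 b2 (fun y hy => hcubic x₀ hx₀ y hy) hs
    rw [hcard₁] at ha
    rw [hcard₂] at hb
    have hg : 4 * s ^ 4 - s ^ 2 + 11 ≠ 0 := by nlinarith [sq_nonneg (s ^ 2 - 1 / 8)]
    generalize {x ∈ X₁ | q / m * inner ℝ y₀ x = s}.card = n₁ at ha
    generalize {x ∈ X₂ | q / m * inner ℝ x₀ x = s}.card = n₂ at hb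
    have hn : (81 * n₁ : ℝ) = 11 * n₂ := by
      apply mul_right_cancel₀ hg
      push_cast at ha hb
      linear_combination 81 * ha - 11 * hb
    have hn' : 81 * n₁ = 11 * n₂ := by exact_mod_cast hn
    obtain ⟨k, rfl⟩ : 11 ∣ n₁ := by omega
    refine ⟨k, ?_⟩
    push_cast at ha
    linarith
  obtain ⟨s₁, s₂, s₃, e₁, e₂, e₃, hroots⟩ := exists_roots_cubic hB0
  obtain ⟨k₁, hk₁⟩ := hmult s₁ (hroots _ (by simp))
  obtain ⟨k₂, hk₂⟩ := hmult s₂ (hroots _ (by simp))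
  obtain ⟨k₃, hk₃⟩ := hmult s₃ (hroots _ (by simp))
  have hB2 := sq_eq_of_multiplicities e₁ e₂ e₃ hk₁ hk₂ hk₃
  obtain ⟨hr, hW⟩ := ratios_eq hr₁ hr₂ hW₁0 hW₂0 hA₂ hA₃ hdiag (by
    rw [← hm]
    simp only [hB, div_pow, mul_pow, hq] at hB2
    field_simp at hB2
    linarith)
  refine ⟨w₁, w₂, hw₁0, hw₂0, hc₁, hc₂, ?_, ?_⟩
  · rw [eq_comm, Real.sqrt_eq_iff_mul_self_eq (by norm_num) (by positivity)]
    field_simp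
    linarith
  · rw [hW₁', hW₂'] at hW
    field_simp at hW ⊢
    linarith
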